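/- arXiv:1702.07563 — 2 statements merged into one kernel-verified Lean document; each statement's English description precedes it below -/
import Mathlib

section
/- Let n ≥ 1 and let Q = (Q^{αβ}_{μν}) be a (2,2)-tensor on ℂⁿ satisfying the symmetries Q^{αβ}_{μν} = Q^{βα}_{μν} and Q^{αβ}_{μν} = Q^{αβ}_{νμ}. Suppose there exists λ ∈ ℂ with λ ≠ 0 such that Q_⊙ S = λ·S for every symmetric n×n complex matrix S (i.e. Q_⊙ is λ times the identity on symmetric matrices). Then the induced endomorphism Q_⋆ of the space of all n×n complex matrices is injective, i.e. Ker(Q_⋆) = {0}. -/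
open Matrix in
/-- A tensor symmetric in its lower indices and acting on symmetric matrices as the scalar `lam`
is `lam` times the symmetrized identity tensor. -/
theorem two_mul_apply_of_forall_isSymm {ι R : Type*} [Fintype ι] [DecidableEq ι] [CommRing R]
    {Q : ι → ι → ι → ι → R} (hsym : ∀ α β μ ν, Q α β μ ν = Q α β ν μ) {lam : R}
    (hQ : ∀ S : Matrix ι ι R, S.IsSymm →
      (Matrix.of fun α β => ∑ μ, ∑ ν, Q α β μ ν * S μ ν) = lam • S) (α β μ ν : ι) :
    2 * Q α β μ ν =
      lam * ((if α = μ ∧ β = ν then 1 else 0) + (if α = ν ∧ β = μ then 1 else 0)) := by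
  have h := congrFun₂ (hQ (single μ ν 1 + single ν μ 1) (by
    simp [IsSymm, transpose_add, transpose_single, add_comm])) α β
  simp only [of_apply, Matrix.add_apply, single_apply, Matrix.smul_apply, smul_eq_mul, mul_add,
    Finset.sum_add_distrib, mul_ite, mul_one, mul_zero, ite_and, Finset.sum_ite_irrel,
    Finset.sum_const_zero, Finset.sum_ite_eq, Finset.mem_univ, if_true] at h
  rw [two_mul]
  nth_rewrite 2 [hsym]
  rw [h]
  simp only [ite_and, mul_add, mul_ite, mul_one, mul_zero, eq_comm]

/-- Lemma 4.2 of the paper, fiberwise form.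
Let `n ≥ 1` and let `Q = (Q^{αβ}_{μν})` be a (2,2)-tensor on `ℂⁿ` with the symmetries
`Q^{αβ}_{μν} = Q^{βα}_{μν}` and `Q^{αβ}_{μν} = Q^{αβ}_{νμ}`.  If there is a `λ ≠ 0`
such that the induced endomorphism `Q_⊙` of symmetric matrices is `λ` times the identity,
then the induced endomorphism `Q_⋆` of all `n × n` matrices has trivial kernel. -/
theorem stmt_0 (n : ℕ) (hn : 1 ≤ n) (Q : Fin n → Fin n → Fin n → Fin n → ℂ)
    (hsym1 : ∀ α β μ ν, Q α β μ ν = Q β α μ ν)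
    (hsym2 : ∀ α β μ ν, Q α β μ ν = Q α β ν μ)
    (lam : ℂ) (hlam : lam ≠ 0)
    (hQ : ∀ S : Matrix (Fin n) (Fin n) ℂ, S.IsSymm →
      (Matrix.of fun α β => ∑ μ, ∑ ν, Q α β μ ν * S μ ν) = lam • S) :
    ∀ T : Matrix (Fin n) (Fin n) ℂ,
      (Matrix.of fun β ν => ∑ α, ∑ μ, Q α β μ ν * T μ α) = 0 → T = 0 := by
  intro T hT
  have key : ∀ β ν, (if β = ν then T.trace else 0) + T β ν = 0 := by
    intro β ν
    have h := congrFun₂ hT β ν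
    have h2 : 2 * ∑ α, ∑ μ, Q α β μ ν * T μ α =
        lam * ((if β = ν then T.trace else 0) + T β ν) := by
      simp only [Finset.mul_sum, ← mul_assoc, two_mul_apply_of_forall_isSymm hsym2 hQ]
      simp [mul_assoc, add_mul, ite_and, Finset.sum_add_distrib, ← Finset.mul_sum,
        Finset.sum_ite_irrel, Matrix.trace]
    rw [Matrix.of_apply, Matrix.zero_apply] at h
    rw [h, mul_zero] at h2
    exact (mul_eq_zero.mp h2.symm).resolve_left hlam
  have htr : T.trace = 0 := by
    have h : ∑ β, (T.trace + T β β) = 0 :=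
      Finset.sum_eq_zero fun β _ => by simpa using key β β
    have h' : ((n : ℂ) + 1) * T.trace = 0 := by
      rw [Finset.sum_add_distrib] at h
      simpa [Matrix.trace, add_mul] using h
    exact (mul_eq_zero.mp h').resolve_left (Nat.cast_add_one_ne_zero n)
  ext β ν
  simpa [htr] using key β ν
end

section
/- Let K be a field and V a K-vector space. For a subspace H ⊆ V, let S²H denote the subspace of V ⊗ V spanned by the set of squares { v ⊗ v : v ∈ H }. If H, E ⊆ V are subspaces with S²H = S²E (as subspaces of V ⊗ V), then H = E. -/
open scoped TensorProduct

/-- If every square of a vector of `H` lies in the span of the squares of vectors of `E`,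
then `H ≤ E`. -/
theorem Submodule.le_of_span_tmul_self_le {K V : Type*} [Field K] [AddCommGroup V] [Module K V]
    {H E : Submodule K V}
    (h : Submodule.span K {x : V ⊗[K] V | ∃ v ∈ H, x = v ⊗ₜ[K] v}
       ≤ Submodule.span K {x : V ⊗[K] V | ∃ v ∈ E, x = v ⊗ₜ[K] v}) :
    H ≤ E := by
  intro v hv
  by_contra hvE
  obtain ⟨f, hfv, hEf⟩ := Submodule.exists_le_ker_of_notMem hvE
  let g : V ⊗[K] V →ₗ[K] K := LinearMap.mul' K K ∘ₗ TensorProduct.map f f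
  have hg : Submodule.span K {x : V ⊗[K] V | ∃ w ∈ E, x = w ⊗ₜ[K] w} ≤ LinearMap.ker g := by
    rw [Submodule.span_le]
    rintro _ ⟨w, hw, rfl⟩
    have hfw : f w = 0 := hEf hw
    simp [g, hfw]
  have hgv : g (v ⊗ₜ[K] v) = 0 := hg (h (Submodule.subset_span ⟨v, hv, rfl⟩))
  exact hfv (by simpa [g] using hgv)

/-- linear-algebraic core of Lemma 6.3(3) of the paper.
For a subspace `H ⊆ V`, let `S²H ⊆ V ⊗ V` denote the span of the set of squares
`{ v ⊗ v : v ∈ H }`.  If two subspaces `H, E ⊆ V` satisfy `S²H = S²E`, then `H = E`. -/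
theorem stmt_8 (K : Type*) [Field K] (V : Type*) [AddCommGroup V] [Module K V]
    (H E : Submodule K V)
    (h : Submodule.span K {x : V ⊗[K] V | ∃ v ∈ H, x = v ⊗ₜ[K] v}
       = Submodule.span K {x : V ⊗[K] V | ∃ v ∈ E, x = v ⊗ₜ[K] v}) :
    H = E :=
  le_antisymm (Submodule.le_of_span_tmul_self_le h.le)
    (Submodule.le_of_span_tmul_self_le h.ge)
end
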